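/- Suppose (u, v, b, p) is a smooth solution of the Eady–Boussinesq vertical slice equations on Ω for t in an open interval I. Then the potential energy P is differentiable on I and dP/dt (t) = −ρ₀ ∫_Ω b u₂ dx dz + ρ₀ b̄_y ∫_Ω v (z − H/2) dx dz for every t ∈ I. -/

import Mathlib

open MeasureTheory

/-- Partial derivative in the `x`-direction of a scalar field on the vertical slice. -/
noncomputable def pdx (g : ℝ × ℝ → ℝ) (p : ℝ × ℝ) : ℝ := fderiv ℝ g p (1, 0)

/-- Partial derivative in the `z`-direction of a scalar field on the vertical slice. -/
noncomputable def pdz (g : ℝ × ℝ → ℝ) (p : ℝ × ℝ) : ℝ := fderiv ℝ g p (0, 1)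

/-- The vertical slice domain `Ω = [−L, L] × [0, H]`. -/
def Omega (L H : ℝ) : Set (ℝ × ℝ) := Set.Icc (-L, 0) (L, H)

/-- A smooth solution of the Eady–Boussinesq vertical slice equations on `Ω = [−L,L]×[0,H]`
for times `t ∈ I`, with constants `ρ₀` (reference density), `f` (Coriolis parameter),
`N2` (squared Brunt–Väisälä frequency) and `bY = ∂b̄/∂y` (constant background buoyancy
gradient).  All fields are smooth, `2L`-periodic in `x`, and the in-slice velocity
satisfies the rigid-lid conditions `u₂ = 0` at `z = 0` and `z = H`. -/
structure EadySolution (L H ρ₀ f N2 bY : ℝ) (I : Set ℝ) where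
  /-- in-slice velocity `u = (u₁, u₂)`, a function of time and of the point `(x, z)` -/
  u : ℝ → ℝ × ℝ → ℝ × ℝ
  /-- out-of-slice velocity `v` -/
  v : ℝ → ℝ × ℝ → ℝ
  /-- buoyancy `b` -/
  b : ℝ → ℝ × ℝ → ℝ
  /-- pressure `p` -/
  p : ℝ → ℝ × ℝ → ℝ
  smooth_u : ContDiff ℝ (⊤ : ℕ∞) fun q : ℝ × (ℝ × ℝ) => u q.1 q.2
  smooth_v : ContDiff ℝ (⊤ : ℕ∞) fun q : ℝ × (ℝ × ℝ) => v q.1 q.2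
  smooth_b : ContDiff ℝ (⊤ : ℕ∞) fun q : ℝ × (ℝ × ℝ) => b q.1 q.2
  smooth_p : ContDiff ℝ (⊤ : ℕ∞) fun q : ℝ × (ℝ × ℝ) => p q.1 q.2
  periodic_u : ∀ t x z : ℝ, u t (x + 2 * L, z) = u t (x, z)
  periodic_v : ∀ t x z : ℝ, v t (x + 2 * L, z) = v t (x, z)
  periodic_b : ∀ t x z : ℝ, b t (x + 2 * L, z) = b t (x, z)
  periodic_p : ∀ t x z : ℝ, p t (x + 2 * L, z) = p t (x, z)
  /-- rigid lid on the lower boundary: `u·ẑ = 0` at `z = 0` -/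
  rigid_bot : ∀ t x : ℝ, (u t (x, 0)).2 = 0
  /-- rigid lid on the upper boundary: `u·ẑ = 0` at `z = H` -/
  rigid_top : ∀ t x : ℝ, (u t (x, H)).2 = 0
  /-- `x̂`-component of `∂u/∂t + (u·∇)u − f v x̂ = −(1/ρ₀)∇p + b ẑ` -/
  mom_x : ∀ t ∈ I, ∀ pt ∈ Omega L H,
    deriv (fun s => (u s pt).1) t
      + (u t pt).1 * pdx (fun q => (u t q).1) pt
      + (u t pt).2 * pdz (fun q => (u t q).1) pt
      - f * v t pt
    = -(1 / ρ₀) * pdx (p t) pt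
  /-- `ẑ`-component of `∂u/∂t + (u·∇)u − f v x̂ = −(1/ρ₀)∇p + b ẑ` -/
  mom_z : ∀ t ∈ I, ∀ pt ∈ Omega L H,
    deriv (fun s => (u s pt).2) t
      + (u t pt).1 * pdx (fun q => (u t q).2) pt
      + (u t pt).2 * pdz (fun q => (u t q).2) pt
    = -(1 / ρ₀) * pdz (p t) pt + b t pt
  /-- `∂v/∂t + u·∇v + f u₁ = −b̄_y (z − H/2)` -/
  mom_v : ∀ t ∈ I, ∀ pt ∈ Omega L H,
    deriv (fun s => v s pt) t
      + (u t pt).1 * pdx (v t) pt + (u t pt).2 * pdz (v t) pt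
      + f * (u t pt).1
    = -bY * (pt.2 - H / 2)
  /-- `∂b/∂t + u·∇b + b̄_y v + N² u₂ = 0` -/
  buoy : ∀ t ∈ I, ∀ pt ∈ Omega L H,
    deriv (fun s => b s pt) t
      + (u t pt).1 * pdx (b t) pt + (u t pt).2 * pdz (b t) pt
      + bY * v t pt + N2 * (u t pt).2
    = 0
  /-- incompressibility `∇·u = 0` -/
  incomp : ∀ t ∈ I, ∀ pt ∈ Omega L H,
    pdx (fun q => (u t q).1) pt + pdz (fun q => (u t q).2) pt = 0

/-- In-slice kinetic energy `K_u(t) = ρ₀ ∫_Ω ½|u|² dx dz`. -/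
noncomputable def Ku (L H ρ₀ : ℝ) (u : ℝ → ℝ × ℝ → ℝ × ℝ) (t : ℝ) : ℝ :=
  ρ₀ * ∫ pt in Omega L H, (1 / 2) * ((u t pt).1 ^ 2 + (u t pt).2 ^ 2)

/-- Out-of-slice kinetic energy `K_v(t) = ρ₀ ∫_Ω ½ v² dx dz`. -/
noncomputable def Kv (L H ρ₀ : ℝ) (v : ℝ → ℝ × ℝ → ℝ) (t : ℝ) : ℝ :=
  ρ₀ * ∫ pt in Omega L H, (1 / 2) * (v t pt) ^ 2

/-- Potential energy `P(t) = −ρ₀ ∫_Ω b (z − H/2) dx dz`. -/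
noncomputable def Pe (L H ρ₀ : ℝ) (b : ℝ → ℝ × ℝ → ℝ) (t : ℝ) : ℝ :=
  -(ρ₀ * ∫ pt in Omega L H, b t pt * (pt.2 - H / 2))

/-- Differentiation under the integral sign for a `C¹` integrand over a compact set. -/
theorem hasDerivAt_setIntegral_of_contDiff {E : Type*} [NormedAddCommGroup E] [NormedSpace ℝ E]
    [MeasurableSpace E] [BorelSpace E] {μ : Measure E}
    [IsFiniteMeasureOnCompacts μ] {K : Set E} (hK : IsCompact K) {g : ℝ × E → ℝ}
    (hg : ContDiff ℝ 1 g) (t : ℝ) :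
    HasDerivAt (fun s => ∫ x in K, g (s, x) ∂μ)
      (∫ x in K, deriv (fun s => g (s, x)) t ∂μ) t := by
  have hderiv (s : ℝ) (x : E) :
      HasDerivAt (fun r => g (r, x)) (fderiv ℝ g (s, x) (1, 0)) s :=
    (hg.differentiable one_ne_zero (s, x)).hasFDerivAt.comp_hasDerivAt s
      ((hasDerivAt_id s).prodMk (hasDerivAt_const s x))
  have hcont : Continuous fun q : ℝ × E => fderiv ℝ g q (1, 0) :=
    (hg.continuous_fderiv one_ne_zero).clm_apply continuous_const
  obtain ⟨C, hC⟩ := ((isCompact_closedBall t (1 : ℝ)).prod hK).exists_bound_of_continuousOn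
    hcont.continuousOn
  have hmeas {h : E → ℝ} (hh : Continuous h) : AEStronglyMeasurable h (μ.restrict K) :=
    hh.continuousOn.aestronglyMeasurable_of_isCompact hK hK.measurableSet
  simp only [fun x => (hderiv t x).deriv]
  refine (hasDerivAt_integral_of_dominated_loc_of_deriv_le
    (F' := fun s x => fderiv ℝ g (s, x) (1, 0)) (bound := fun _ => C)
    (Metric.closedBall_mem_nhds t one_pos) (.of_forall fun s => hmeas ?_) ?_ (hmeas ?_) ?_ ?_ ?_).2
  · exact hg.continuous.comp (by fun_prop)
  · exact (hg.continuous.comp (by fun_prop : Continuous fun x : E => (t, x))).continuousOn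
      |>.integrableOn_compact hK
  · exact hcont.comp (by fun_prop)
  · filter_upwards [ae_restrict_mem hK.measurableSet] with x hx s hs
    exact hC (s, x) ⟨hs, hx⟩
  · exact (continuousOn_const (c := C)).integrableOn_compact hK
  · exact .of_forall fun x s _ => hderiv s x

/-- A `C¹` vector field on the slice that is periodic in `x` and has no normal component on the
lids has a divergence of zero mean. -/
theorem setIntegral_Omega_divergence_eq_zero {L H : ℝ} (hL : 0 ≤ L) (hH : 0 ≤ H)
    {F G : ℝ × ℝ → ℝ} (hF : ContDiff ℝ 1 F) (hG : ContDiff ℝ 1 G)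
    (hper : ∀ z, F (L, z) = F (-L, z)) (hbot : ∀ x, G (x, 0) = 0) (htop : ∀ x, G (x, H) = 0) :
    ∫ q in Omega L H, (pdx F q + pdz G q) = 0 := by
  have h := integral_divergence_prod_Icc_of_hasFDerivAt_of_le F G (fderiv ℝ F) (fderiv ℝ G)
    (-L, 0) (L, H) ⟨by simpa using hL, hH⟩ hF.continuous.continuousOn hG.continuous.continuousOn
    (fun x _ => (hF.differentiable one_ne_zero x).hasFDerivAt)
    (fun x _ => (hG.differentiable one_ne_zero x).hasFDerivAt)
    ((((hF.continuous_fderiv one_ne_zero).clm_apply continuous_const).add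
      ((hG.continuous_fderiv one_ne_zero).clm_apply
        continuous_const)).continuousOn.integrableOn_compact isCompact_Icc)
  simpa [hper, hbot, htop, Omega, pdx, pdz] using h

theorem ContDiff.continuous_pdx {g : ℝ × ℝ → ℝ} (hg : ContDiff ℝ 1 g) : Continuous (pdx g) :=
  (hg.continuous_fderiv one_ne_zero).clm_apply continuous_const

theorem ContDiff.continuous_pdz {g : ℝ × ℝ → ℝ} (hg : ContDiff ℝ 1 g) : Continuous (pdz g) :=
  (hg.continuous_fderiv one_ne_zero).clm_apply continuous_const

theorem pdx_mul {g h : ℝ × ℝ → ℝ} {q : ℝ × ℝ} (hg : DifferentiableAt ℝ g q)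
    (hh : DifferentiableAt ℝ h q) :
    pdx (fun r => g r * h r) q = g q * pdx h q + h q * pdx g q := by
  simp [pdx, fderiv_fun_mul hg hh]

theorem pdz_mul {g h : ℝ × ℝ → ℝ} {q : ℝ × ℝ} (hg : DifferentiableAt ℝ g q)
    (hh : DifferentiableAt ℝ h q) :
    pdz (fun r => g r * h r) q = g q * pdz h q + h q * pdz g q := by
  simp [pdz, fderiv_fun_mul hg hh]

/-- First partial derivatives of `g (z - c) + N (z - c)² / 2`. -/
theorem pdx_pdz_mul_add_sq {g : ℝ × ℝ → ℝ} {q : ℝ × ℝ} (hg : DifferentiableAt ℝ g q) (c N : ℝ) :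
    pdx (fun r => g r * (r.2 - c) + N / 2 * (r.2 - c) ^ 2) q = pdx g q * (q.2 - c) ∧
      pdz (fun r => g r * (r.2 - c) + N / 2 * (r.2 - c) ^ 2) q
        = pdz g q * (q.2 - c) + g q + N * (q.2 - c) := by
  have hw : HasFDerivAt (fun r : ℝ × ℝ => r.2 - c) (ContinuousLinearMap.snd ℝ ℝ ℝ) q :=
    hasFDerivAt_snd.sub_const c
  have h := (hg.hasFDerivAt.mul hw).add ((hw.pow 2).const_mul (N / 2))
  have h' : fderiv ℝ (fun r => g r * (r.2 - c) + N / 2 * (r.2 - c) ^ 2) q = _ := h.fderiv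
  constructor
  · simp [pdx, h']; ring
  · simp [pdz, h']; ring

/-- For a smooth solution of the Eady–Boussinesq vertical slice equations on `Ω` for `t` in
an open interval `I = (a, c)`, the potential energy `P` is differentiable on `I` with
`dP/dt (t) = −ρ₀ ∫_Ω b u₂ dx dz + ρ₀ b̄_y ∫_Ω v (z − H/2) dx dz` for every `t ∈ I`. -/
theorem Pe_hasDerivAt (L H ρ₀ f N2 bY a c : ℝ) (hL : 0 < L) (hH : 0 < H) (hρ : 0 < ρ₀)
    (sol : EadySolution L H ρ₀ f N2 bY (Set.Ioo a c)) :
    ∀ t ∈ Set.Ioo a c,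
      HasDerivAt (Pe L H ρ₀ sol.b)
        (-(ρ₀ * ∫ pt in Omega L H, sol.b t pt * (sol.u t pt).2)
          + ρ₀ * bY * ∫ pt in Omega L H, sol.v t pt * (pt.2 - H / 2)) t := by
  intro t ht
  have hb : ContDiff ℝ 1 (sol.b t) :=
    (sol.smooth_b.of_le (by simp)).comp (contDiff_const.prodMk contDiff_id)
  have hv : ContDiff ℝ 1 (sol.v t) :=
    (sol.smooth_v.of_le (by simp)).comp (contDiff_const.prodMk contDiff_id)
  have hu : ContDiff ℝ 1 (sol.u t) :=
    (sol.smooth_u.of_le (by simp)).comp (contDiff_const.prodMk contDiff_id)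
  have hu₁ : ContDiff ℝ 1 fun q => (sol.u t q).1 := hu.fst
  have hu₂ : ContDiff ℝ 1 fun q => (sol.u t q).2 := hu.snd
  set φ : ℝ × ℝ → ℝ := fun q => sol.b t q * (q.2 - H / 2) + N2 / 2 * (q.2 - H / 2) ^ 2 with hφ_def
  have hφ : ContDiff ℝ 1 φ := by fun_prop
  have hbt : ContDiff ℝ 1 fun q : ℝ × (ℝ × ℝ) => sol.b q.1 q.2 * (q.2.2 - H / 2) :=
    (sol.smooth_b.of_le (by simp)).mul (by fun_prop)
  have hcompact : IsCompact (Omega L H) := isCompact_Icc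
  have hintOn {g : ℝ × ℝ → ℝ} (hg : Continuous g) : IntegrableOn g (Omega L H) :=
    hg.continuousOn.integrableOn_compact hcompact
  have hF : ContDiff ℝ 1 fun q => (sol.u t q).1 * φ q := hu₁.mul hφ
  have hG : ContDiff ℝ 1 fun q => (sol.u t q).2 * φ q := hu₂.mul hφ
  have hdiv : ∫ q in Omega L H, (pdx (fun q => (sol.u t q).1 * φ q) q
      + pdz (fun q => (sol.u t q).2 * φ q) q) = 0 := by
    refine setIntegral_Omega_divergence_eq_zero hL.le hH.le hF hG (fun z => ?_)
      (fun x => by simp [sol.rigid_bot]) (fun x => by simp [sol.rigid_top])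
    have hperu := sol.periodic_u t (-L) z
    have hperb := sol.periodic_b t (-L) z
    rw [show -L + 2 * L = L by ring] at hperu hperb
    simp only [hφ_def, hperu, hperb]
  have hpoint : ∀ q ∈ Omega L H, deriv (fun s => sol.b s q * (q.2 - H / 2)) t
      = sol.b t q * (sol.u t q).2 - bY * (sol.v t q * (q.2 - H / 2))
        - (pdx (fun q => (sol.u t q).1 * φ q) q + pdz (fun q => (sol.u t q).2 * φ q) q) := by
    intro q hq
    have hbq : DifferentiableAt ℝ (fun s => sol.b s q) t :=
      ((sol.smooth_b.differentiable (by simp)).comp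
        (differentiable_id.prodMk (differentiable_const q))) t
    obtain ⟨hφx, hφz⟩ := pdx_pdz_mul_add_sq (hb.differentiable one_ne_zero q) (H / 2) N2
    rw [deriv_mul_const hbq,
      pdx_mul (hu₁.differentiable one_ne_zero q) (hφ.differentiable one_ne_zero q),
      pdz_mul (hu₂.differentiable one_ne_zero q) (hφ.differentiable one_ne_zero q), hφx, hφz]
    linear_combination (q.2 - H / 2) * sol.buoy t ht q hq + φ q * sol.incomp t ht q hq
  have hderiv := hasDerivAt_setIntegral_of_contDiff (μ := volume) hcompact hbt t
  have hbu : Continuous fun q => sol.b t q * (sol.u t q).2 := hb.continuous.mul hu₂.continuous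
  have hvw : Continuous fun q => bY * (sol.v t q * (q.2 - H / 2)) := by
    have := hv.continuous
    fun_prop
  refine (hderiv.const_mul ρ₀).neg.congr_deriv ?_
  rw [setIntegral_congr_fun hcompact.measurableSet hpoint,
    integral_sub (hintOn (hbu.fun_sub hvw)) (hintOn (hF.continuous_pdx.fun_add hG.continuous_pdz)),
    integral_sub (hintOn hbu) (hintOn hvw), hdiv, integral_const_mul]
  ring
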